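/- Suppose a < 0, b > 0 and a + b < 0, and fix t > 0. Then the limit lim_{Δ→∞} Δ^{1 + b/a} · Cov(X(t), X(t+Δ)) exists as a real number and is strictly positive. -/

import Mathlib

open MeasureTheory ProbabilityTheory Filter Real Set

noncomputable section

/-- `B` is a standard one-dimensional Brownian motion adapted to the filtration `F`
under the probability measure `P`: all paths are continuous and start at `0`, the
increment `B t - B s` is Gaussian with mean `0` and variance `t - s`, and increments
after time `s` are independent of `F s`. -/
def IsStdBrownian {Ω : Type*} {mΩ : MeasurableSpace Ω} (P : Measure Ω)
    (F : MeasureTheory.Filtration ℝ mΩ) (B : ℝ → Ω → ℝ) : Prop :=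
  MeasureTheory.Adapted F B ∧
  (∀ ω, B 0 ω = 0) ∧
  (∀ ω, Continuous fun t => B t ω) ∧
  (∀ s t : ℝ, 0 ≤ s → s ≤ t →
    P.map (fun ω => B t ω - B s ω) = gaussianReal 0 (Real.toNNReal (t - s))) ∧
  (∀ s t : ℝ, 0 ≤ s → s ≤ t →
    Indep (MeasurableSpace.comap (fun ω => B t ω - B s ω) Real.measurableSpace) (F s) P)

/-- `X` is the (continuous, adapted) solution of the affine stochastic functional
differential equation `dX(t) = (a X(t) + b/(1+t) ∫_{-1}^t X(s) ds) dt + σ dB(t)` for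
`t ≥ 0`, with initial history `ψ` on `[-1, 0]`; i.e. almost surely, for all `t ≥ 0`,
`X t = ψ 0 + ∫_0^t (a X(s) + b/(1+s) (∫_{-1}^0 ψ(u) du + ∫_0^s X(u) du)) ds + σ B t`. -/
def IsSolutionSFDE {Ω : Type*} {mΩ : MeasurableSpace Ω} (P : Measure Ω)
    (F : MeasureTheory.Filtration ℝ mΩ) (a b σ : ℝ) (ψ : ℝ → ℝ)
    (B X : ℝ → Ω → ℝ) : Prop :=
  (∀ t : ℝ, 0 ≤ t → StronglyMeasurable[F t] (X t)) ∧
  (∀ ω, ContinuousOn (fun t => X t ω) (Set.Ici (0 : ℝ))) ∧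
  (∀ᵐ ω ∂P, ∀ t : ℝ, 0 ≤ t →
    X t ω = ψ 0
      + (∫ s in (0:ℝ)..t,
          (a * X s ω + b / (1 + s) * ((∫ u in (-1:ℝ)..(0:ℝ), ψ u) + ∫ u in (0:ℝ)..s, X u ω)))
      + σ * B t ω)

/-- The covariance `Cov(Y, Z) = E[Y Z] - E[Y] E[Z]` of two real random variables. -/
def rcov {Ω : Type*} {mΩ : MeasurableSpace Ω} (P : Measure Ω) (Y Z : Ω → ℝ) : ℝ :=
  (∫ ω, Y ω * Z ω ∂P) - (∫ ω, Y ω ∂P) * (∫ ω, Z ω ∂P)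

lemma le_of_hasDerivAt_nonneg {p p' : ℝ → ℝ} {u v : ℝ} (huv : u ≤ v)
    (hp : ∀ x ∈ Icc u v, HasDerivAt p (p' x) x) (h0 : ∀ x ∈ Icc u v, 0 ≤ p' x) : p u ≤ p v := by
  refine monotoneOn_of_deriv_nonneg (convex_Icc u v)
    (fun x hx => (hp x hx).continuousAt.continuousWithinAt) ?_ ?_
    (left_mem_Icc.2 huv) (right_mem_Icc.2 huv) huv
  · intro x hx
    exact (hp x (interior_subset hx)).differentiableAt.differentiableWithinAt
  · intro x hx
    rw [(hp x (interior_subset hx)).deriv]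
    exact h0 x (interior_subset hx)

/-- Linear differential inequality `e' ≤ -l e` on `[u, v]`. -/
lemma le_mul_exp_of_hasDerivAt_le {e e' : ℝ → ℝ} {l u v : ℝ} (huv : u ≤ v)
    (he : ∀ x ∈ Icc u v, HasDerivAt e (e' x) x) (h : ∀ x ∈ Icc u v, e' x ≤ -l * e x) :
    e v ≤ e u * exp (-l * (v - u)) := by
  have key : -(e u * exp (l * u)) ≤ -(e v * exp (l * v)) := by
    refine le_of_hasDerivAt_nonneg (p := fun x => -(e x * exp (l * x)))
      (p' := fun x => -(e' x * exp (l * x) + e x * (exp (l * x) * (l * 1)))) huv ?_ ?_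
    · intro x hx
      exact ((he x hx).mul (((hasDerivAt_id x).const_mul l).exp)).neg
    · intro x hx
      nlinarith [h x hx, exp_pos (l * x)]
  have h2 : e v * exp (l * v) ≤ e u * exp (l * u) := by linarith
  have h3 : e u * exp (-l * (v - u)) = e u * exp (l * u) * exp (-(l * v)) := by
    rw [mul_assoc, ← exp_add]; ring_nf
  rw [h3]
  calc e v = e v * exp (l * v) * exp (-(l * v)) := by
        rw [mul_assoc, ← exp_add]; simp
    _ ≤ _ := by gcongr

lemma tendsto_of_hasDerivAt_relaxation {h p r : ℝ → ℝ} {α R u₀ : ℝ} (hα : 0 < α)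
    (hh : ∀ u, u₀ ≤ u → HasDerivAt h (-p u * h u + r u) u)
    (hp : Tendsto p atTop (nhds α)) (hr : Tendsto r atTop (nhds R)) :
    Tendsto h atTop (nhds (R / α)) := by
  set z : ℝ → ℝ := fun u => h u - R / α with hz
  set ε : ℝ → ℝ := fun u => r u - p u * (R / α) with hε
  have hε0 : Tendsto ε atTop (nhds 0) := by
    have := hr.sub (hp.mul_const (R / α))
    rwa [mul_div_cancel₀ R hα.ne', sub_self] at this
  have hz' : ∀ u, u₀ ≤ u → HasDerivAt z (-p u * z u + ε u) u := by
    intro u hu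
    refine ((hh u hu).sub_const (R / α)).congr_deriv ?_
    simp only [hz, hε]; ring
  suffices hs : Tendsto (fun u => z u ^ 2) atTop (nhds 0) by
    have h1 : Tendsto z atTop (nhds 0) := by
      rw [tendsto_zero_iff_abs_tendsto_zero]
      have := hs.sqrt
      simp only [Real.sqrt_zero, Real.sqrt_sq_eq_abs] at this
      exact this
    have h2 := h1.add_const (R / α)
    simpa [hz] using h2
  rw [Metric.tendsto_atTop]
  intro δ hδ
  have e1 : ∀ᶠ u in atTop, α / 2 < p u := hp.eventually (lt_mem_nhds (by linarith))
  have e2 : ∀ᶠ u in atTop, ε u ^ 2 < δ * α ^ 2 / 8 := by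
    have := hε0.pow 2
    refine this.eventually (gt_mem_nhds ?_)
    simp only [ne_eq, OfNat.ofNat_ne_zero, not_false_eq_true, zero_pow]
    positivity
  obtain ⟨N, hN⟩ := eventually_atTop.1 (e1.and (e2.and (eventually_ge_atTop u₀)))
  have hmain : ∀ u, N ≤ u → z u ^ 2 - δ / 2 ≤ (z N ^ 2 - δ / 2) * exp (-(α / 2) * (u - N)) := by
    intro u hu
    refine le_mul_exp_of_hasDerivAt_le (e := fun x => z x ^ 2 - δ / 2)
      (e' := fun x => 2 * z x * (-p x * z x + ε x)) hu ?_ ?_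
    · intro x hx
      obtain ⟨-, -, h3⟩ := hN x hx.1
      refine (((hz' x h3).pow 2).sub_const (δ / 2)).congr_deriv ?_
      simp
    · intro x hx
      obtain ⟨h1, h2, -⟩ := hN x hx.1
      have h4 : 0 ≤ (α * z x / 2 - ε x) ^ 2 := sq_nonneg _
      have h5 : (p x - α / 2) * z x ^ 2 ≥ 0 := mul_nonneg (by linarith) (sq_nonneg _)
      have h6 : 2 * z x * ε x ≤ α / 2 * z x ^ 2 + 2 / α * ε x ^ 2 := by
        have : α / 2 * z x ^ 2 + 2 / α * ε x ^ 2 - 2 * z x * ε x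
            = 2 / α * (α * z x / 2 - ε x) ^ 2 := by field_simp; ring
        have h7 : 0 ≤ 2 / α * (α * z x / 2 - ε x) ^ 2 := by positivity
        linarith
      have h8 : 2 / α * ε x ^ 2 ≤ 2 / α * (δ * α ^ 2 / 8) := by gcongr
      have h9 : 2 / α * (δ * α ^ 2 / 8) = δ * α / 4 := by field_simp; norm_num
      nlinarith
  have hexp : Tendsto (fun u => (z N ^ 2 - δ / 2) * exp (-(α / 2) * (u - N))) atTop (nhds 0) := by
    have h1 : Tendsto (fun u : ℝ => -(α / 2) * (u - N)) atTop atBot :=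
      (tendsto_atTop_add_const_right _ (-N) tendsto_id).const_mul_atTop_of_neg (by linarith)
    have := (tendsto_exp_atBot.comp h1).const_mul (z N ^ 2 - δ / 2)
    simpa using this
  obtain ⟨N', hN'⟩ := eventually_atTop.1
    ((hexp.eventually (gt_mem_nhds (show (0 : ℝ) < δ / 2 by linarith))).and
      (eventually_ge_atTop N))
  refine ⟨N', fun u hu => ?_⟩
  obtain ⟨h1, h2⟩ := hN' u hu
  have := hmain u h2
  rw [Real.dist_eq, sub_zero, abs_of_nonneg (sq_nonneg _)]
  linarith

/-- Exact polynomial rate for nonnegative solutions of `y'' = -α y' + b y / (1 + u)`. -/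
lemma exists_tendsto_rpow_mul_deriv {α b u₀ : ℝ} {f y : ℝ → ℝ} (hα : 0 < α) (hb : 0 < b)
    (hu₀ : 0 ≤ u₀) (hy : ∀ u, u₀ ≤ u → HasDerivAt y (f u) u)
    (hf : ∀ u, u₀ ≤ u → HasDerivAt f (-α * f u + b / (1 + u) * y u) u)
    (hf0 : ∀ u, u₀ ≤ u → 0 ≤ f u) (hy0 : 0 < y u₀) :
    ∃ c : ℝ, 0 < c ∧ Tendsto (fun u => (1 + u) ^ (1 - b / α) * f u) atTop (nhds c) := by
  set γ := b / α with hγ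
  have hγ0 : 0 < γ := by positivity
  have hbγ : b = γ * α := by rw [hγ]; field_simp
  have hypos : ∀ u, u₀ ≤ u → 0 < y u := fun u hu =>
    hy0.trans_le (le_of_hasDerivAt_nonneg hu (fun x hx => hy x hx.1) fun x hx => hf0 x hx.1)
  set L : ℝ → ℝ := fun u => y u + f u / α with hL
  have hLpos : ∀ u, u₀ ≤ u → 0 < L u := fun u hu =>
    add_pos_of_pos_of_nonneg (hypos u hu) (div_nonneg (hf0 u hu) hα.le)
  have hv : ∀ u, u₀ ≤ u → 0 < 1 + u := fun u hu => by linarith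
  have hL' : ∀ u, u₀ ≤ u → HasDerivAt L (γ * y u / (1 + u)) u := by
    intro u hu
    refine ((hy u hu).add ((hf u hu).div_const α)).congr_deriv ?_
    have := (hv u hu).ne'
    rw [hγ]; field_simp; ring
  set w : ℝ → ℝ := fun u => L u * (1 + u) ^ (-γ) with hw
  set h : ℝ → ℝ := fun u => (1 + u) ^ (1 - γ) * f u with hh
  have hpow : ∀ (q u : ℝ), u₀ ≤ u →
      HasDerivAt (fun u : ℝ => (1 + u) ^ q) (q * (1 + u) ^ q / (1 + u)) u := by
    intro q u hu
    have h1 : HasDerivAt (fun u : ℝ => 1 + u) 1 u := (hasDerivAt_id u).const_add 1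
    refine (h1.rpow_const (p := q) (Or.inl (hv u hu).ne')).congr_deriv ?_
    rw [rpow_sub_one (hv u hu).ne']; ring
  have hpow1 : ∀ u, u₀ ≤ u → (1 + u) ^ (1 - γ) = (1 + u) * (1 + u) ^ (-γ) := by
    intro u hu
    rw [sub_eq_add_neg, rpow_add (hv u hu), rpow_one]
  have hw' : ∀ u, u₀ ≤ u → HasDerivAt w (-(γ / α) * (f u * (1 + u) ^ (-γ)) / (1 + u)) u := by
    intro u hu
    refine ((hL' u hu).mul (hpow (-γ) u hu)).congr_deriv ?_
    have := (hv u hu).ne'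
    simp only [hL]; field_simp; ring
  have hwpos : ∀ u, u₀ ≤ u → 0 < w u := fun u hu =>
    mul_pos (hLpos u hu) (rpow_pos_of_pos (hv u hu) _)
  have hwanti : ∀ u v, u₀ ≤ u → u ≤ v → w v ≤ w u := by
    intro u v hu huv
    have := le_of_hasDerivAt_nonneg (p := fun x => -w x) huv
      (fun x hx => (hw' x (hu.trans hx.1)).neg) (fun x hx => by
        have h1 := hv x (hu.trans hx.1)
        have h2 := hf0 x (hu.trans hx.1)
        have h3 := rpow_pos_of_pos h1 (-γ)
        have : 0 ≤ γ / α * (f x * (1 + x) ^ (-γ)) / (1 + x) := by positivity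
        rw [neg_mul, neg_div, neg_neg]; exact this)
    linarith
  -- the weighted derivative `(1 + u) f u` is dominated by `y`
  obtain ⟨u₁, hu₁, M, hM, hdom⟩ : ∃ u₁, u₀ ≤ u₁ ∧ ∃ M, 0 < M ∧
      ∀ u, u₁ ≤ u → f u * (1 + u) ≤ M * y u := by
    refine ⟨max u₀ (2 / α), le_max_left _ _, ?_⟩
    set u₁ := max u₀ (2 / α) with hu₁
    have h01 : u₀ ≤ u₁ := le_max_left _ _
    set M := max (2 * b / α) (f u₁ * (1 + u₁) / y u₁) with hM
    have hM1 : 2 * b / α ≤ M := le_max_left _ _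
    have hM2 : f u₁ * (1 + u₁) ≤ M * y u₁ := by
      rw [← div_le_iff₀ (hypos u₁ h01)]; exact le_max_right _ _
    have hMpos : 0 < M := lt_of_lt_of_le (by positivity) hM1
    refine ⟨M, hMpos, fun u hu => ?_⟩
    have key := le_mul_exp_of_hasDerivAt_le (l := α / 2)
      (e := fun x => f x * (1 + x) - M * y x)
      (e' := fun x => (-α * f x + b / (1 + x) * y x) * (1 + x) + f x * 1 - M * f x) hu
      (fun x hx => (((hf x (h01.trans hx.1)).mul
        ((hasDerivAt_id x).const_add 1)).sub ((hy x (h01.trans hx.1)).const_mul M)))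
      (fun x hx => by
        have hx0 := h01.trans hx.1
        have h1 := hv x hx0
        have h2 := hf0 x hx0
        have h3 := hypos x hx0
        have h4 : 2 / α ≤ x := (le_max_right _ _).trans hx.1
        rw [div_le_iff₀ hα] at h4
        rw [div_le_iff₀ hα] at hM1
        have h5 : b / (1 + x) * y x * (1 + x) = b * y x := by field_simp
        have h6 : 0 ≤ (x * α - 2) * f x := mul_nonneg (by linarith) h2
        have h7 : 0 ≤ (M * α - 2 * b) * y x := mul_nonneg (by linarith) h3.le
        have h8 : 0 ≤ M * f x := by positivity
        have h9 : 0 ≤ α * f x := by positivity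
        rw [add_mul, h5]
        nlinarith)
    have h2 : (f u₁ * (1 + u₁) - M * y u₁) * exp (-(α / 2) * (u - u₁)) ≤ 0 :=
      mul_nonpos_of_nonpos_of_nonneg (by linarith) (exp_pos _).le
    linarith
  set κ := γ / α * M with hκ
  have hκ0 : 0 < κ := by positivity
  have hlow : ∀ u, u₁ ≤ u → w u₁ * exp (-κ / (1 + u₁)) ≤ w u := by
    intro u hu
    have key := le_of_hasDerivAt_nonneg (p := fun x => w x * exp (-κ / (1 + x)))
      (p' := fun x => -(γ / α) * (f x * (1 + x) ^ (-γ)) / (1 + x) * exp (-κ / (1 + x)) +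
        w x * (exp (-κ / (1 + x)) * (κ / (1 + x) ^ 2))) hu
      (fun x hx => by
        have hx0 := hu₁.trans hx.1
        have h1 : HasDerivAt (fun x : ℝ => -κ / (1 + x)) (κ / (1 + x) ^ 2) x := by
          have := (hasDerivAt_const x (-κ)).div ((hasDerivAt_id x).const_add 1) (hv x hx0).ne'
          refine this.congr_deriv ?_
          simp
        exact (hw' x hx0).mul h1.exp)
      (fun x hx => by
        have hx0 := hu₁.trans hx.1
        have h1 := hv x hx0
        have h3 := rpow_pos_of_pos h1 (-γ)
        have h4 : f x * (1 + x) ≤ M * L x := (hdom x hx.1).trans (by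
          have := div_nonneg (hf0 x hx0) hα.le
          simp only [hL]; nlinarith)
        have h5 : -(γ / α) * (f x * (1 + x) ^ (-γ)) / (1 + x) * exp (-κ / (1 + x)) +
            w x * (exp (-κ / (1 + x)) * (κ / (1 + x) ^ 2)) =
            (γ / α) * (1 + x) ^ (-γ) * exp (-κ / (1 + x)) / (1 + x) ^ 2 *
              (M * L x - f x * (1 + x)) := by
          simp only [hw, hκ]; field_simp; ring
        rw [h5]
        exact mul_nonneg (by positivity) (by linarith))
    refine key.trans ?_
    have : exp (-κ / (1 + u)) ≤ 1 := by
      rw [exp_le_one_iff]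
      exact div_nonpos_of_nonpos_of_nonneg (by linarith) (hv u (hu₁.trans hu)).le
    have h1 := hwpos u (hu₁.trans hu)
    nlinarith
  obtain ⟨W, hW, hWlim⟩ : ∃ W, 0 < W ∧ Tendsto w atTop (nhds W) := by
    have hanti : Antitone (fun u => w (max u u₁)) := fun u v huv =>
      hwanti _ _ (hu₁.trans (le_max_right _ _)) (max_le_max_right _ huv)
    have hbd : w u₁ * exp (-κ / (1 + u₁)) ∈ lowerBounds (range fun u => w (max u u₁)) := by
      rintro _ ⟨u, rfl⟩
      exact hlow _ (le_max_right _ _)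
    refine ⟨⨅ u, w (max u u₁), ?_, ?_⟩
    · refine lt_of_lt_of_le (mul_pos (hwpos u₁ hu₁) (exp_pos (-κ / (1 + u₁)))) (le_ciInf fun u => ?_)
      exact hlow _ (le_max_right _ _)
    · refine (tendsto_atTop_ciInf hanti ⟨_, hbd⟩).congr' ?_
      filter_upwards [eventually_ge_atTop u₁] with u hu
      rw [max_eq_left hu]
  refine ⟨b * W / α, by positivity, ?_⟩
  refine tendsto_of_hasDerivAt_relaxation (p := fun u => α - (1 - 2 * γ) * (1 + u)⁻¹)
    (r := fun u => b * w u) (u₀ := u₀) hα ?_ ?_ (hWlim.const_mul b)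
  · intro u hu
    refine ((hpow (1 - γ) u hu).mul (hf u hu)).congr_deriv ?_
    have h1 := (hv u hu)
    simp only [hw, hL, hh]
    rw [hpow1 u hu, hbγ]
    field_simp
    ring
  · have h1 : Tendsto (fun u : ℝ => (1 + u)⁻¹) atTop (nhds 0) :=
      tendsto_inv_atTop_zero.comp (tendsto_atTop_add_const_left _ 1 tendsto_id)
    simpa using (h1.const_mul (1 - 2 * γ)).const_sub α

/-- Positivity for the Volterra equation `f = ∫ (a f + k ∫ f) + g` with nondecreasing
forcing `g`. -/
lemma exp_mul_le_of_volterra {a b : ℝ} {f k g : ℝ → ℝ} (ha : a ≤ 0) (hb : 0 ≤ b)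
    (hf : Continuous f) (hk : Continuous k) (hk0 : ∀ u, 0 ≤ u → 0 ≤ k u)
    (hkb : ∀ u, 0 ≤ u → k u ≤ b) (hg : MonotoneOn g (Ici 0)) (hg0 : 0 ≤ g 0)
    (heq : ∀ u, 0 ≤ u → f u = (∫ s in (0:ℝ)..u, (a * f s + k s * ∫ w in (0:ℝ)..s, f w)) + g u)
    {u : ℝ} (hu : 0 ≤ u) : exp (a * u) * g u ≤ f u := by
  set y : ℝ → ℝ := fun s => ∫ w in (0:ℝ)..s, f w with hy
  have hy' : ∀ s, HasDerivAt y (f s) s := fun s => (hf.integral_hasStrictDerivAt 0 s).hasDerivAt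
  have hyc : Continuous y := continuous_iff_continuousAt.2 fun s => (hy' s).continuousAt
  set G : ℝ → ℝ := fun u => ∫ s in (0:ℝ)..u, (a * f s + k s * y s) with hG
  have hG' : ∀ s, HasDerivAt G (a * f s + k s * y s) s := fun s =>
    (((hf.const_mul a).add (hk.mul hyc)).integral_hasStrictDerivAt 0 s).hasDerivAt
  have hfG : ∀ u, 0 ≤ u → f u = G u + g u := heq
  set m : ℝ → ℝ := fun s => max (-y s) 0 with hm
  have hmc : Continuous m := hyc.neg.max continuous_const
  have hm0 : ∀ s, 0 ≤ m s := fun s => le_max_right _ _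
  have hym : ∀ s, -m s ≤ y s := fun s => by
    have : -y s ≤ m s := le_max_left _ _
    linarith
  set N : ℝ → ℝ := fun u => ∫ s in (0:ℝ)..u, m s with hN
  have hN' : ∀ s, HasDerivAt N (m s) s := fun s => (hmc.integral_hasStrictDerivAt 0 s).hasDerivAt
  have hN0 : N 0 = 0 := intervalIntegral.integral_same
  have hNmono : ∀ s v, s ≤ v → N s ≤ N v := fun s v hsv =>
    le_of_hasDerivAt_nonneg hsv (fun x _ => hN' x) fun x _ => hm0 x
  have hlow : ∀ u, 0 ≤ u → exp (a * u) * g u - b * N u ≤ f u := by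
    intro u hu
    have key := le_of_hasDerivAt_nonneg
      (p := fun v => exp (-a * v) * (G v + g u) + exp (-a * u) * b * N v)
      (p' := fun v => exp (-a * v) * (-a * 1) * (G v + g u) +
        exp (-a * v) * (a * f v + k v * y v) + exp (-a * u) * b * m v) hu
      (fun v _ => ((((hasDerivAt_id v).const_mul (-a)).exp).mul
        ((hG' v).add_const (g u))).add ((hN' v).const_mul _))
      (fun v hv => by
        have h1 : g v ≤ g u := hg hv.1 hu hv.2
        have h2 : 0 ≤ a * (g v - g u) := mul_nonneg_of_nonpos_of_nonpos ha (by linarith)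
        have h3 : -(b * m v) ≤ k v * y v := by
          have h4 := hk0 v hv.1
          have h5 := hkb v hv.1
          nlinarith [hm0 v, hym v]
        have h4 : exp (-a * v) ≤ exp (-a * u) := by
          apply exp_le_exp.2
          nlinarith [hv.2]
        have h5 := exp_pos (-a * v)
        have h6 : 0 ≤ b * m v := mul_nonneg hb (hm0 v)
        rw [hfG v hv.1]
        have h7 : exp (-a * v) * (-a * 1) * (G v + g u) +
          exp (-a * v) * (a * (G v + g v) + k v * y v) + exp (-a * u) * b * m v =
          exp (-a * v) * (a * (g v - g u)) + exp (-a * v) * (k v * y v + b * m v) +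
            (exp (-a * u) - exp (-a * v)) * (b * m v) := by ring
        rw [h7]
        have h8 := mul_nonneg h5.le h2
        have h9 := mul_nonneg h5.le (show 0 ≤ k v * y v + b * m v by linarith)
        have h10 := mul_nonneg (sub_nonneg.2 h4) h6
        linarith)
    have hG0 : G 0 = 0 := intervalIntegral.integral_same
    rw [hN0, hG0, mul_zero, exp_zero, ← hfG u hu] at key
    have h1 : exp (a * u) * exp (-a * u) = 1 := by rw [← exp_add]; simp
    have h2 := mul_le_mul_of_nonneg_left key (exp_pos (a * u)).le
    have h3 : exp (a * u) * (exp (-a * u) * f u + exp (-a * u) * b * N u) =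
        (exp (a * u) * exp (-a * u)) * (f u + b * N u) := by ring
    rw [h3, h1] at h2
    linarith
  have hgnn : ∀ u, 0 ≤ u → 0 ≤ g u := fun u hu => hg0.trans (hg self_mem_Ici hu hu)
  have hmN : ∀ u, 0 ≤ u → m u ≤ b * u * N u := by
    intro u hu
    have hNu : 0 ≤ N u := hN0 ▸ hNmono 0 u hu
    have key := le_of_hasDerivAt_nonneg (p := fun v => y v + b * N u * v)
      (p' := fun v => f v + b * N u * 1) hu
      (fun v _ => (hy' v).add ((hasDerivAt_id v).const_mul _))
      (fun v hv => by
        have h1 := hlow v hv.1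
        have h2 := mul_nonneg (exp_pos (a * v)).le (hgnn v hv.1)
        have h3 := mul_le_mul_of_nonneg_left (hNmono v u hv.2) hb
        linarith)
    have hy0 : y 0 = 0 := intervalIntegral.integral_same
    rw [hy0] at key
    refine max_le ?_ (by positivity)
    linarith
  have hNu : N u ≤ 0 := by
    have key := le_mul_exp_of_hasDerivAt_le (l := -(b * u)) hu (fun x _ => hN' x) (fun x hx => by
      have h1 := hmN x hx.1
      have h2 : 0 ≤ N x := hN0 ▸ hNmono 0 x hx.1
      have h3 : b * x * N x ≤ b * u * N x := by
        have := hx.2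
        gcongr
      linarith)
    simpa [hN0] using key
  have := hlow u hu
  nlinarith

lemma sq_integral_mul_le {α : Type*} {mα : MeasurableSpace α} {μ : Measure α} {f g : α → ℝ}
    (hf : MemLp f 2 μ) (hg : MemLp g 2 μ) :
    (∫ x, f x * g x ∂μ) ^ 2 ≤ (∫ x, f x ^ 2 ∂μ) * ∫ x, g x ^ 2 ∂μ := by
  have hfg : Integrable (fun x => f x * g x) μ := hf.integrable_mul hg
  have key := discrim_le_zero (a := ∫ x, f x ^ 2 ∂μ) (b := 2 * ∫ x, f x * g x ∂μ)
    (c := ∫ x, g x ^ 2 ∂μ) (fun z => by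
      have h1 : 0 ≤ ∫ x, (z * f x + g x) ^ 2 ∂μ := integral_nonneg fun x => sq_nonneg _
      have h2 : ∫ x, (z * f x + g x) ^ 2 ∂μ =
          ∫ x, (z * z * f x ^ 2 + 2 * z * (f x * g x)) + g x ^ 2 ∂μ := by
        congr 1; ext x; ring
      have h3 : Integrable (fun x => z * z * f x ^ 2 + 2 * z * (f x * g x)) μ :=
        (hf.integrable_sq.const_mul _).add (hfg.const_mul _)
      rw [h2, integral_add h3
        hg.integrable_sq, integral_add (hf.integrable_sq.const_mul _) (hfg.const_mul _),
        integral_const_mul, integral_const_mul] at h1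
      linarith)
  rw [discrim] at key
  linarith

lemma memLp_two_integral_abs {Ω : Type*} {mΩ : MeasurableSpace Ω} {P : Measure Ω}
    [IsFiniteMeasure P] {R : ℝ → Ω → ℝ} {T : ℝ} (hm : Measurable (Function.uncurry R))
    (hR : MemLp (Function.uncurry R) 2 ((volume.restrict (Ioc 0 T)).prod P)) :
    MemLp (fun ω => ∫ s in Ioc 0 T, |R s ω|) 2 P := by
  have hmeas : StronglyMeasurable fun ω => ∫ s in Ioc 0 T, |R s ω| :=
    StronglyMeasurable.integral_prod_left (f := fun s ω => |R s ω|)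
      (continuous_abs.measurable.comp hm).stronglyMeasurable
  rw [memLp_two_iff_integrable_sq hmeas.aestronglyMeasurable]
  have hsq := hR.integrable_sq
  refine Integrable.mono' (hsq.integral_prod_right.const_mul
    ((volume.restrict (Ioc 0 T)).real univ)) (hmeas.pow 2).aestronglyMeasurable ?_
  filter_upwards [hsq.prod_left_ae] with ω hω
  have h1 : MemLp (fun s => |R s ω|) 2 (volume.restrict (Ioc 0 T)) := by
    have : Measurable fun s => |R s ω| :=
      continuous_abs.measurable.comp (hm.comp measurable_prodMk_right)
    rw [memLp_two_iff_integrable_sq this.aestronglyMeasurable]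
    simpa [sq_abs] using hω
  have h2 := sq_integral_mul_le (memLp_const (1 : ℝ)) h1
  rw [norm_of_nonneg (sq_nonneg _)]
  simpa [sq_abs] using h2

lemma integral_mul_intervalIntegral {Ω : Type*} {mΩ : MeasurableSpace Ω} {P : Measure Ω}
    [IsFiniteMeasure P] {R : ℝ → Ω → ℝ} {Z : Ω → ℝ} {T : ℝ} (hT : 0 ≤ T) (hZ : MemLp Z 2 P)
    (hR : MemLp (Function.uncurry R) 2 ((volume.restrict (Ioc 0 T)).prod P)) :
    IntegrableOn (fun s => ∫ ω, Z ω * R s ω ∂P) (Ioc 0 T) ∧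
      ∫ ω, Z ω * (∫ s in (0:ℝ)..T, R s ω) ∂P = ∫ s in (0:ℝ)..T, ∫ ω, Z ω * R s ω ∂P := by
  have hint : Integrable (Function.uncurry fun s ω => Z ω * R s ω)
      ((volume.restrict (Ioc 0 T)).prod P) :=
    (hZ.comp_snd (volume.restrict (Ioc 0 T))).integrable_mul hR
  refine ⟨hint.integral_prod_left, ?_⟩
  simp only [intervalIntegral.integral_of_le hT]
  rw [integral_integral_swap hint]
  congr 1; ext ω
  rw [integral_const_mul]

/-- Pathwise Gronwall bound for the Volterra equation. -/
lemma exists_forall_abs_le_of_volterra (a b σ x₀ I₀ T : ℝ) (hb : 0 ≤ b) (hσ : 0 ≤ σ)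
    (hT : 0 ≤ T) {k : ℝ → ℝ} (hk : Continuous k) (hk0 : ∀ u, 0 ≤ u → |k u| ≤ b) :
    ∃ C : ℝ, ∀ x β : ℝ → ℝ, Continuous x → Continuous β →
      (∀ u, 0 ≤ u → x u = x₀ +
        (∫ s in (0:ℝ)..u, (a * x s + k s * (I₀ + ∫ w in (0:ℝ)..s, x w))) + σ * β u) →
      ∀ u ∈ Icc 0 T, |x u| ≤ C + C * (∫ s in (0:ℝ)..T, |β s|) + σ * |β u| := by
  set c := |x₀| + b * |I₀| * T with hc
  set L := |a| + b * T with hL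
  have hc0 : 0 ≤ c := by positivity
  have hL0 : 0 ≤ L := by positivity
  refine ⟨max (c + L * (exp (L * T) * (c * T))) (L * (exp (L * T) * σ)), ?_⟩
  intro x β hx hβ heq
  set n : ℝ → ℝ := fun u => ∫ s in (0:ℝ)..u, |x s| with hn
  have hn' : ∀ s, HasDerivAt n |x s| s := fun s =>
    (hx.abs.integral_hasStrictDerivAt 0 s).hasDerivAt
  have hnc : Continuous n := continuous_iff_continuousAt.2 fun s => (hn' s).continuousAt
  have hn0 : n 0 = 0 := intervalIntegral.integral_same
  have hnmono : ∀ s v, s ≤ v → n s ≤ n v := fun s v hsv =>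
    le_of_hasDerivAt_nonneg hsv (fun x _ => hn' x) fun x _ => abs_nonneg _
  have hyc : Continuous fun s => ∫ w in (0:ℝ)..s, x w :=
    continuous_iff_continuousAt.2 fun s => (hx.integral_hasStrictDerivAt 0 s).hasDerivAt.continuousAt
  have hstep : ∀ u ∈ Icc 0 T, |x u| ≤ c + L * n u + σ * |β u| := by
    intro u hu
    have h1 : |∫ s in (0:ℝ)..u, (a * x s + k s * (I₀ + ∫ w in (0:ℝ)..s, x w))| ≤
        ∫ s in (0:ℝ)..u, (|a| * |x s| + b * (|I₀| + n u)) := by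
      refine (intervalIntegral.abs_integral_le_integral_abs hu.1).trans ?_
      refine intervalIntegral.integral_mono_on hu.1 ?_ ?_ ?_
      · exact (((hx.const_mul a).add (hk.mul (hyc.const_add I₀))).abs).intervalIntegrable _ _
      · exact ((hx.abs.const_mul |a|).add continuous_const).intervalIntegrable _ _
      · intro s hs
        refine (abs_add_le _ _).trans ?_
        rw [abs_mul, abs_mul]
        have h2 : |I₀ + ∫ w in (0:ℝ)..s, x w| ≤ |I₀| + n u := by
          refine (abs_add_le _ _).trans ?_
          have := intervalIntegral.abs_integral_le_integral_abs (f := x) (μ := volume) hs.1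
          have := hnmono s u hs.2
          linarith
        have := mul_le_mul (hk0 s hs.1) h2 (abs_nonneg _) hb
        linarith
    rw [intervalIntegral.integral_add ((hx.abs.const_mul |a|).intervalIntegrable _ _)
      (intervalIntegrable_const), intervalIntegral.integral_const_mul,
      intervalIntegral.integral_const, smul_eq_mul, sub_zero] at h1
    have hnu : 0 ≤ n u := hn0 ▸ hnmono 0 u hu.1
    have h3 : u * (b * (|I₀| + n u)) ≤ T * (b * (|I₀| + n u)) := by
      have := hu.2
      gcongr
    rw [heq u hu.1]
    refine (abs_add_le _ _).trans ?_
    have h4 : |σ * β u| = σ * |β u| := by rw [abs_mul, abs_of_nonneg hσ]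
    rw [h4]
    have h5 := abs_add_le x₀ (∫ s in (0:ℝ)..u, (a * x s + k s * (I₀ + ∫ w in (0:ℝ)..s, x w)))
    have h6 : (∫ s in (0:ℝ)..u, |x s|) = n u := rfl
    rw [h6] at h1
    have h7 : c + L * n u = |x₀| + (|a| * n u + T * (b * (|I₀| + n u))) := by
      rw [hc, hL]; ring
    linarith
  set J := ∫ s in (0:ℝ)..T, |β s| with hJ
  have hJu : ∀ u ∈ Icc 0 T, ∫ s in (0:ℝ)..u, (c + σ * |β s|) ≤ c * T + σ * J := by
    intro u hu
    have hcont : Continuous fun s => c + σ * |β s| := continuous_const.add (hβ.abs.const_mul σ)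
    have h1 := le_of_hasDerivAt_nonneg (p := fun u => ∫ s in (0:ℝ)..u, (c + σ * |β s|)) hu.2
      (fun x _ => (hcont.integral_hasStrictDerivAt 0 x).hasDerivAt) fun x _ => by positivity
    refine h1.trans (le_of_eq ?_)
    rw [intervalIntegral.integral_add intervalIntegrable_const
      ((hβ.abs.const_mul σ).intervalIntegrable _ _), intervalIntegral.integral_const,
      intervalIntegral.integral_const_mul, smul_eq_mul, sub_zero, mul_comm T c]
  have hnb : ∀ u ∈ Icc 0 T, n u ≤ exp (L * T) * (c * T + σ * J) := by
    intro u hu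
    have hcont : Continuous fun s => c + σ * |β s| := continuous_const.add (hβ.abs.const_mul σ)
    have key := le_of_hasDerivAt_nonneg
      (p := fun v => (∫ s in (0:ℝ)..v, (c + σ * |β s|)) - exp (-L * v) * n v)
      (p' := fun v => (c + σ * |β v|) - (exp (-L * v) * (-L * 1) * n v + exp (-L * v) * |x v|))
      hu.1
      (fun v _ => ((hcont.integral_hasStrictDerivAt 0 v).hasDerivAt).sub
        ((((hasDerivAt_id v).const_mul (-L)).exp).mul (hn' v)))
      (fun v hv => by
        have h1 := hstep v ⟨hv.1, hv.2.trans hu.2⟩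
        have h2 : exp (-L * v) ≤ 1 := exp_le_one_iff.2 (by nlinarith [hv.1])
        have h3 := exp_pos (-L * v)
        have h4 : 0 ≤ c + σ * |β v| := by positivity
        nlinarith)
    simp only [intervalIntegral.integral_same, hn0, mul_zero, sub_zero] at key
    have h1 : exp (-L * u) * n u ≤ c * T + σ * J := by linarith [hJu u hu]
    have h2 : n u = exp (L * u) * (exp (-L * u) * n u) := by
      rw [← mul_assoc, ← exp_add]; simp
    have hnu : 0 ≤ n u := hn0 ▸ hnmono 0 u hu.1
    rw [h2]
    have h3 : L * u ≤ L * T := by have := hu.2; gcongr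
    have h4 : exp (L * u) ≤ exp (L * T) := exp_le_exp.2 h3
    exact mul_le_mul h4 h1 (mul_nonneg (exp_pos _).le hnu) (exp_pos _).le
  intro u hu
  have hJ0 : 0 ≤ J := intervalIntegral.integral_nonneg hT fun s _ => abs_nonneg _
  have h1 := hstep u hu
  have h2 := mul_le_mul_of_nonneg_left (hnb u hu) hL0
  have h3 : c + L * (exp (L * T) * (c * T)) ≤
    max (c + L * (exp (L * T) * (c * T))) (L * (exp (L * T) * σ)) := le_max_left _ _
  have h4 := mul_le_mul_of_nonneg_right (le_max_right (c + L * (exp (L * T) * (c * T)))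
    (L * (exp (L * T) * σ))) hJ0
  have h5 : L * (exp (L * T) * (c * T + σ * J)) =
    L * (exp (L * T) * (c * T)) + L * (exp (L * T) * σ) * J := by ring
  linarith

/-- A square-integrable noise `B` with continuous paths and a continuous process `X` solving
`X u = x₀ + ∫_0^u (a X s + k s (I₀ + ∫_0^s X)) ds + σ B u` for `u ≥ 0`. -/
structure IsVolterraSolution {Ω : Type*} {mΩ : MeasurableSpace Ω} (P : Measure Ω)
    (a σ x₀ I₀ : ℝ) (k : ℝ → ℝ) (B X : ℝ → Ω → ℝ) : Prop where
  measurable_noise : ∀ s, Measurable (B s)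
  continuous_noise : ∀ ω, Continuous fun s => B s ω
  memLp_noise : ∀ s, 0 ≤ s → MemLp (B s) 2 P
  memLp_uncurry_noise : ∀ T,
    MemLp (Function.uncurry B) 2 ((volume.restrict (Ioc 0 T)).prod P)
  measurable : ∀ s, Measurable (X s)
  continuous : ∀ ω, Continuous fun s => X s ω
  eq_of_neg : ∀ s ≤ 0, X s = X 0
  eqn : ∀ᵐ ω ∂P, ∀ u, 0 ≤ u → X u ω = x₀ +
    (∫ s in (0:ℝ)..u, (a * X s ω + k s * (I₀ + ∫ w in (0:ℝ)..s, X w ω))) + σ * B u ω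

namespace IsVolterraSolution

variable {Ω : Type*} {mΩ : MeasurableSpace Ω} {P : Measure Ω}
  {a b σ x₀ I₀ : ℝ} {k : ℝ → ℝ} {B X : ℝ → Ω → ℝ}

lemma measurable_uncurry (h : IsVolterraSolution P a σ x₀ I₀ k B X) :
    Measurable (Function.uncurry X) :=
  measurable_uncurry_of_continuous_of_measurable h.continuous h.measurable

lemma measurable_uncurry_noise (h : IsVolterraSolution P a σ x₀ I₀ k B X) :
    Measurable (Function.uncurry B) :=
  measurable_uncurry_of_continuous_of_measurable h.continuous_noise h.measurable_noise

lemma measurable_uncurry_integral (h : IsVolterraSolution P a σ x₀ I₀ k B X) :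
    Measurable (Function.uncurry fun s ω => ∫ w in (0:ℝ)..s, X w ω) := by
  refine measurable_uncurry_of_continuous_of_measurable
    (fun ω => continuous_iff_continuousAt.2 fun s =>
      ((h.continuous ω).integral_hasStrictDerivAt 0 s).hasDerivAt.continuousAt) fun s => ?_
  have h1 (S : Set ℝ) : Measurable fun ω => ∫ w in S, X w ω :=
    (StronglyMeasurable.integral_prod_left (f := fun w ω => X w ω)
      h.measurable_uncurry.stronglyMeasurable).measurable
  exact (h1 _).sub (h1 _)

variable [IsProbabilityMeasure P]

lemma exists_memLp_bound (h : IsVolterraSolution P a σ x₀ I₀ k B X) (hb : 0 ≤ b) (hσ : 0 ≤ σ)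
    (hk : Continuous k) (hkb : ∀ u, 0 ≤ u → |k u| ≤ b) {T : ℝ} (hT : 0 ≤ T) :
    ∃ N : Ω → ℝ, Measurable N ∧ MemLp N 2 P ∧
      ∀ᵐ ω ∂P, ∀ u ∈ Icc 0 T, |X u ω| ≤ N ω + σ * |B u ω| := by
  obtain ⟨C, hC⟩ := exists_forall_abs_le_of_volterra a b σ x₀ I₀ T hb hσ hT hk hkb
  refine ⟨fun ω => C + C * ∫ s in Ioc 0 T, |B s ω|, ?_, ?_, ?_⟩
  · exact ((StronglyMeasurable.integral_prod_left (f := fun s ω => |B s ω|)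
      (continuous_abs.measurable.comp
        h.measurable_uncurry_noise).stronglyMeasurable).measurable.const_mul C).const_add C
  · exact (memLp_const C).add ((memLp_two_integral_abs h.measurable_uncurry_noise
      (h.memLp_uncurry_noise T)).const_mul C)
  · filter_upwards [h.eqn] with ω hω u hu
    have := hC _ _ (h.continuous ω) (h.continuous_noise ω) hω u hu
    rwa [intervalIntegral.integral_of_le hT] at this

lemma memLp (h : IsVolterraSolution P a σ x₀ I₀ k B X) (hb : 0 ≤ b) (hσ : 0 ≤ σ)
    (hk : Continuous k) (hkb : ∀ u, 0 ≤ u → |k u| ≤ b) {u : ℝ} (hu : 0 ≤ u) :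
    MemLp (X u) 2 P := by
  obtain ⟨N, -, hN, hle⟩ := h.exists_memLp_bound hb hσ hk hkb hu
  refine (hN.add ((h.memLp_noise u hu).abs.const_mul σ)).mono'
    (h.measurable u).aestronglyMeasurable ?_
  filter_upwards [hle] with ω hω
  exact hω u ⟨hu, le_rfl⟩

lemma memLp_uncurry (h : IsVolterraSolution P a σ x₀ I₀ k B X) (hb : 0 ≤ b) (hσ : 0 ≤ σ)
    (hk : Continuous k) (hkb : ∀ u, 0 ≤ u → |k u| ≤ b) {T : ℝ} (hT : 0 ≤ T) :
    MemLp (Function.uncurry X) 2 ((volume.restrict (Ioc 0 T)).prod P) := by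
  obtain ⟨N, hNm, hN, hle⟩ := h.exists_memLp_bound hb hσ hk hkb hT
  refine ((hN.comp_snd (volume.restrict (Ioc 0 T))).add
    ((h.memLp_uncurry_noise T).abs.const_mul σ)).mono'
    h.measurable_uncurry.aestronglyMeasurable ?_
  have hms : MeasurableSet {z : ℝ × Ω | |X z.1 z.2| ≤ N z.2 + σ * |B z.1 z.2|} :=
    measurableSet_le (continuous_abs.measurable.comp h.measurable_uncurry)
      ((hNm.comp measurable_snd).add
        ((continuous_abs.measurable.comp h.measurable_uncurry_noise).const_mul σ))
  refine (Measure.ae_prod_iff_ae_ae hms).2 ?_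
  filter_upwards [ae_restrict_mem measurableSet_Ioc] with s hs
  filter_upwards [hle] with ω hω
  exact hω s (Ioc_subset_Icc_self hs)

lemma memLp_uncurry_drift (h : IsVolterraSolution P a σ x₀ I₀ k B X) (hb : 0 ≤ b) (hσ : 0 ≤ σ)
    (hk : Continuous k) (hkb : ∀ u, 0 ≤ u → |k u| ≤ b) {T : ℝ} (hT : 0 ≤ T) :
    MemLp (Function.uncurry fun s ω => a * X s ω + k s * (I₀ + ∫ w in (0:ℝ)..s, X w ω)) 2
      ((volume.restrict (Ioc 0 T)).prod P) := by
  have hX := h.memLp_uncurry hb hσ hk hkb hT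
  refine (hX.const_mul a).add ?_
  have hJ := memLp_two_integral_abs h.measurable_uncurry hX
  refine (((memLp_const |I₀|).add (hJ.comp_snd (volume.restrict (Ioc 0 T)))).const_mul b).mono'
    ((hk.measurable.comp measurable_fst).mul
      (h.measurable_uncurry_integral.const_add I₀)).aestronglyMeasurable ?_
  have hfst : ∀ᵐ z : ℝ × Ω ∂((volume.restrict (Ioc 0 T)).prod P), z.1 ∈ Ioc 0 T :=
    Measure.quasiMeasurePreserving_fst.ae (ae_restrict_mem measurableSet_Ioc)
  filter_upwards [hfst] with z hz
  simp only [Real.norm_eq_abs, abs_mul]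
  refine mul_le_mul (hkb _ hz.1.le) ((abs_add_le _ _).trans ?_) (abs_nonneg _) hb
  refine add_le_add_right ?_ _
  refine (intervalIntegral.abs_integral_le_integral_abs hz.1.le).trans ?_
  rw [intervalIntegral.integral_of_le hz.1.le]
  refine setIntegral_mono_set ((h.continuous z.2).abs.integrableOn_Ioc)
    (Eventually.of_forall fun _ => abs_nonneg _) ?_
  exact (Ioc_subset_Ioc_right hz.2).eventuallyLE

/-- Testing against a centred square-integrable variable turns the random Volterra equation
into a deterministic one. -/
lemma test_eq (h : IsVolterraSolution P a σ x₀ I₀ k B X) (hb : 0 ≤ b) (hσ : 0 ≤ σ)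
    (hk : Continuous k) (hkb : ∀ u, 0 ≤ u → |k u| ≤ b) {Z : Ω → ℝ} (hZ : MemLp Z 2 P)
    (hZ0 : ∫ ω, Z ω ∂P = 0) {u : ℝ} (hu : 0 ≤ u) :
    IntegrableOn (fun s => a * (∫ ω, Z ω * X s ω ∂P) +
        k s * ∫ w in (0:ℝ)..s, ∫ ω, Z ω * X w ω ∂P) (Ioc 0 u) ∧
      ∫ ω, Z ω * X u ω ∂P = (∫ s in (0:ℝ)..u, (a * (∫ ω, Z ω * X s ω ∂P) +
        k s * ∫ w in (0:ℝ)..s, ∫ ω, Z ω * X w ω ∂P)) + σ * ∫ ω, Z ω * B u ω ∂P := by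
  have hZi : Integrable Z P := hZ.integrable (by norm_num)
  have hdrift := h.memLp_uncurry_drift hb hσ hk hkb hu
  have hinner : ∀ s ∈ Ioc 0 u,
      ∫ ω, Z ω * (a * X s ω + k s * (I₀ + ∫ w in (0:ℝ)..s, X w ω)) ∂P =
        a * (∫ ω, Z ω * X s ω ∂P) + k s * ∫ w in (0:ℝ)..s, ∫ ω, Z ω * X w ω ∂P := by
    intro s hs
    have hXs := h.memLp_uncurry hb hσ hk hkb hs.1.le
    have h1 : Integrable (fun ω => Z ω * X s ω) P :=
      hZ.integrable_mul (h.memLp hb hσ hk hkb hs.1.le)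
    have hY : MemLp (fun ω => ∫ w in (0:ℝ)..s, X w ω) 2 P := by
      refine (memLp_two_integral_abs h.measurable_uncurry hXs).mono'
        (h.measurable_uncurry_integral.comp measurable_prodMk_left).aestronglyMeasurable ?_
      refine Eventually.of_forall fun ω => ?_
      rw [← intervalIntegral.integral_of_le hs.1.le]
      exact intervalIntegral.abs_integral_le_integral_abs hs.1.le
    have h2 : Integrable (fun ω => Z ω * ∫ w in (0:ℝ)..s, X w ω) P := hZ.integrable_mul hY
    have h3 : ∀ ω, Z ω * (a * X s ω + k s * (I₀ + ∫ w in (0:ℝ)..s, X w ω)) =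
        a * (Z ω * X s ω) + (k s * I₀ * Z ω + k s * (Z ω * ∫ w in (0:ℝ)..s, X w ω)) := by
      intro ω; ring
    have h4 : Integrable
        (fun ω => k s * I₀ * Z ω + k s * (Z ω * ∫ w in (0:ℝ)..s, X w ω)) P :=
      (hZi.const_mul _).add (h2.const_mul _)
    simp only [h3]
    rw [integral_add (h1.const_mul a) h4, integral_add (hZi.const_mul _) (h2.const_mul _),
      integral_const_mul, integral_const_mul, integral_const_mul, hZ0, mul_zero, zero_add,
      (integral_mul_intervalIntegral hs.1.le hZ hXs).2]
  obtain ⟨hi, hswap⟩ := integral_mul_intervalIntegral hu hZ hdrift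
  refine ⟨hi.congr_fun hinner measurableSet_Ioc, ?_⟩
  have hD : MemLp (fun ω => ∫ s in (0:ℝ)..u,
      (a * X s ω + k s * (I₀ + ∫ w in (0:ℝ)..s, X w ω))) 2 P := by
    have hmeas : Measurable (Function.uncurry fun s ω =>
        a * X s ω + k s * (I₀ + ∫ w in (0:ℝ)..s, X w ω)) :=
      (h.measurable_uncurry.const_mul a).add ((hk.measurable.comp measurable_fst).mul
        (h.measurable_uncurry_integral.const_add I₀))
    refine (memLp_two_integral_abs hmeas hdrift).mono' ?_ ?_
    · simp only [intervalIntegral.integral_of_le hu]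
      exact (StronglyMeasurable.integral_prod_left
        (f := fun s ω => a * X s ω + k s * (I₀ + ∫ w in (0:ℝ)..s, X w ω))
        hmeas.stronglyMeasurable).aestronglyMeasurable
    · refine Eventually.of_forall fun ω => ?_
      rw [← intervalIntegral.integral_of_le hu]
      exact intervalIntegral.abs_integral_le_integral_abs hu
  have h1 : ∫ ω, Z ω * X u ω ∂P = ∫ ω, (x₀ * Z ω + Z ω * (∫ s in (0:ℝ)..u,
      (a * X s ω + k s * (I₀ + ∫ w in (0:ℝ)..s, X w ω)))) + σ * (Z ω * B u ω) ∂P := by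
    refine integral_congr_ae ?_
    filter_upwards [h.eqn] with ω hω
    rw [hω u hu]; ring
  have hZD : Integrable (fun ω => Z ω * (∫ s in (0:ℝ)..u,
      (a * X s ω + k s * (I₀ + ∫ w in (0:ℝ)..s, X w ω)))) P := hZ.integrable_mul hD
  have hZB : Integrable (fun ω => Z ω * B u ω) P := hZ.integrable_mul (h.memLp_noise u hu)
  have hsum : Integrable (fun ω => x₀ * Z ω + Z ω * (∫ s in (0:ℝ)..u,
      (a * X s ω + k s * (I₀ + ∫ w in (0:ℝ)..s, X w ω)))) P := (hZi.const_mul _).add hZD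
  rw [h1, integral_add hsum (hZB.const_mul _), integral_add (hZi.const_mul _) hZD,
    integral_const_mul, integral_const_mul, hZ0, mul_zero, zero_add, hswap,
    intervalIntegral.integral_of_le hu, intervalIntegral.integral_of_le hu,
    setIntegral_congr_fun measurableSet_Ioc hinner]

lemma continuous_test (h : IsVolterraSolution P a σ x₀ I₀ k B X) (hb : 0 ≤ b) (hσ : 0 ≤ σ)
    (hk : Continuous k) (hkb : ∀ u, 0 ≤ u → |k u| ≤ b) {Z : Ω → ℝ} (hZ : MemLp Z 2 P)
    (hZ0 : ∫ ω, Z ω ∂P = 0) (hg : ContinuousOn (fun u => ∫ ω, Z ω * B u ω ∂P) (Ici 0)) :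
    Continuous fun u => ∫ ω, Z ω * X u ω ∂P := by
  have hon : ContinuousOn (fun u => ∫ ω, Z ω * X u ω ∂P) (Ici 0) := by
    refine continuousOn_of_locally_continuousOn fun x hx => ⟨Iio (x + 1), isOpen_Iio, by simp, ?_⟩
    have hx1 : 0 ≤ x + 1 := by
      have : (0:ℝ) ≤ x := hx
      linarith
    have hprim : ContinuousOn (fun u => ∫ s in (0:ℝ)..u, (a * (∫ ω, Z ω * X s ω ∂P) +
        k s * ∫ w in (0:ℝ)..s, ∫ ω, Z ω * X w ω ∂P)) (Icc 0 (x + 1)) := by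
      have := intervalIntegral.continuousOn_primitive_interval (μ := volume) (a := 0) (b := x + 1)
        (f := fun s => a * (∫ ω, Z ω * X s ω ∂P) +
          k s * ∫ w in (0:ℝ)..s, ∫ ω, Z ω * X w ω ∂P) (by
        rw [uIcc_of_le hx1, integrableOn_Icc_iff_integrableOn_Ioc]
        exact (h.test_eq hb hσ hk hkb hZ hZ0 hx1).1)
      rwa [uIcc_of_le hx1] at this
    have hsub : Ici 0 ∩ Iio (x + 1) ⊆ Icc 0 (x + 1) := fun v hv => ⟨hv.1, hv.2.le⟩
    refine ((hprim.mono hsub).add ((hg.mono inter_subset_left).const_mul σ)).congr ?_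
    intro v hv
    exact (h.test_eq hb hσ hk hkb hZ hZ0 hv.1).2
  have hcomp : Continuous fun u : ℝ => ∫ ω, Z ω * X (max u 0) ω ∂P :=
    hon.comp_continuous (f := fun u : ℝ => max u 0) (by fun_prop) fun u => mem_Ici.2 (le_max_right _ _)
  convert hcomp using 2 with u
  rcases le_total 0 u with hu | hu
  · rw [max_eq_left hu]
  · rw [max_eq_right hu, h.eq_of_neg u hu]

/-- Positive association between the solution and a test variable whose correlation with the
noise is nondecreasing. -/
lemma exp_mul_le_test (h : IsVolterraSolution P a σ x₀ I₀ k B X) (ha : a ≤ 0) (hb : 0 ≤ b)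
    (hσ : 0 ≤ σ) (hk : Continuous k) (hk0 : ∀ u, 0 ≤ u → 0 ≤ k u) (hkb : ∀ u, 0 ≤ u → |k u| ≤ b)
    {Z : Ω → ℝ} (hZ : MemLp Z 2 P) (hZ0 : ∫ ω, Z ω ∂P = 0)
    (hg : ContinuousOn (fun u => ∫ ω, Z ω * B u ω ∂P) (Ici 0))
    (hmono : MonotoneOn (fun u => ∫ ω, Z ω * B u ω ∂P) (Ici 0))
    (hg0 : 0 ≤ ∫ ω, Z ω * B 0 ω ∂P) {u : ℝ} (hu : 0 ≤ u) :
    exp (a * u) * (σ * ∫ ω, Z ω * B u ω ∂P) ≤ ∫ ω, Z ω * X u ω ∂P :=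
  exp_mul_le_of_volterra (f := fun u => ∫ ω, Z ω * X u ω ∂P)
    (g := fun u => σ * ∫ ω, Z ω * B u ω ∂P) ha hb
    (h.continuous_test hb hσ hk hkb hZ hZ0 hg) hk hk0 (fun _ hu => (le_abs_self _).trans (hkb _ hu))
    (fun _ hu _ hv huv => mul_le_mul_of_nonneg_left (hmono hu hv huv) hσ)
    (mul_nonneg hσ hg0) (fun _ hu => (h.test_eq hb hσ hk hkb hZ hZ0 hu).2) hu

end IsVolterraSolution

namespace IsStdBrownian

variable {Ω : Type*} {mΩ : MeasurableSpace Ω} {P : Measure Ω}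
  {F : MeasureTheory.Filtration ℝ mΩ} {B : ℝ → Ω → ℝ}

lemma measurable (hB : IsStdBrownian P F B) (s : ℝ) : Measurable (B s) :=
  (hB.1 s).mono (F.le s) le_rfl

lemma memLp_sub (hB : IsStdBrownian P F B) {s u : ℝ} (hs : 0 ≤ s) (hsu : s ≤ u) :
    MemLp (fun ω => B u ω - B s ω) 2 P := by
  have hm : Measurable fun ω => B u ω - B s ω := (hB.measurable u).sub (hB.measurable s)
  have h1 : MemLp id 2 (P.map fun ω => B u ω - B s ω) := by
    rw [hB.2.2.2.1 s u hs hsu]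
    exact memLp_id_gaussianReal 2
  exact (memLp_map_measure_iff aestronglyMeasurable_id hm.aemeasurable).1 h1

lemma integral_sub (hB : IsStdBrownian P F B) {s u : ℝ} (hs : 0 ≤ s) (hsu : s ≤ u) :
    ∫ ω, (B u ω - B s ω) ∂P = 0 := by
  have hm : Measurable fun ω => B u ω - B s ω := (hB.measurable u).sub (hB.measurable s)
  have h1 := integral_map (μ := P) (f := fun x : ℝ => x) hm.aemeasurable aestronglyMeasurable_id
  rw [← h1, hB.2.2.2.1 s u hs hsu]
  exact integral_id_gaussianReal

lemma integral_sub_sq (hB : IsStdBrownian P F B) {s u : ℝ} (hs : 0 ≤ s) (hsu : s ≤ u) :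
    ∫ ω, (B u ω - B s ω) ^ 2 ∂P = u - s := by
  have hm : Measurable fun ω => B u ω - B s ω := (hB.measurable u).sub (hB.measurable s)
  have h1 := integral_map (μ := P) (f := fun x : ℝ => x ^ 2) hm.aemeasurable
    (continuous_pow 2).aestronglyMeasurable
  rw [← h1, hB.2.2.2.1 s u hs hsu]
  have h2 := variance_id_gaussianReal (μ := 0) (v := Real.toNNReal (u - s))
  rw [variance_of_integral_eq_zero aemeasurable_id (by simp)] at h2
  simpa [Real.coe_toNNReal _ (sub_nonneg.2 hsu)] using h2

lemma memLp (hB : IsStdBrownian P F B) {s : ℝ} (hs : 0 ≤ s) : MemLp (B s) 2 P := by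
  simpa [hB.2.1] using hB.memLp_sub le_rfl hs

lemma integral_sq (hB : IsStdBrownian P F B) {s : ℝ} (hs : 0 ≤ s) :
    ∫ ω, B s ω ^ 2 ∂P = s := by
  simpa [hB.2.1] using hB.integral_sub_sq le_rfl hs

/-- Increments are orthogonal to the past. -/
lemma integral_mul_sub (hB : IsStdBrownian P F B) {s u : ℝ} (hs : 0 ≤ s) (hsu : s ≤ u)
    {W : Ω → ℝ} (hW : Measurable[F s] W) : ∫ ω, W ω * (B u ω - B s ω) ∂P = 0 := by
  have hind : IndepFun (fun ω => B u ω - B s ω) W P := by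
    rw [IndepFun_iff_Indep]
    exact indep_of_indep_of_le_right (hB.2.2.2.2 s u hs hsu) hW.comap_le
  have h := hind.symm.integral_mul_eq_mul_integral
    (hW.mono (F.le s) le_rfl).aestronglyMeasurable
    ((hB.measurable u).sub (hB.measurable s)).aestronglyMeasurable
  rw [hB.integral_sub hs hsu, mul_zero] at h
  exact h

lemma integral_mul (hB : IsStdBrownian P F B) {s u : ℝ} (hs : 0 ≤ s) (hu : 0 ≤ u) :
    ∫ ω, B s ω * B u ω ∂P = min s u := by
  wlog hsu : s ≤ u generalizing s u
  · rw [min_comm, ← this hu hs (le_of_not_ge hsu)]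
    simp only [mul_comm]
  have h1 := hB.integral_mul_sub hs hsu (hB.1 s)
  have h2 : ∀ ω, B s ω * (B u ω - B s ω) = B s ω * B u ω - B s ω ^ 2 := fun ω => by ring
  simp only [h2] at h1
  have hi : Integrable (fun ω => B s ω * B u ω) P := (hB.memLp hs).integrable_mul (hB.memLp hu)
  rw [MeasureTheory.integral_sub hi (hB.memLp hs).integrable_sq, hB.integral_sq hs] at h1
  rw [min_eq_left hsu]
  linarith

lemma memLp_uncurry [IsFiniteMeasure P] (hB : IsStdBrownian P F B) (T : ℝ) :
    MemLp (Function.uncurry B) 2 ((volume.restrict (Ioc 0 T)).prod P) := by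
  have hm : Measurable (Function.uncurry B) :=
    measurable_uncurry_of_continuous_of_measurable hB.2.2.1 hB.measurable
  rw [memLp_two_iff_integrable_sq hm.aestronglyMeasurable,
    integrable_prod_iff (hm.pow_const 2).aestronglyMeasurable]
  constructor
  · filter_upwards [ae_restrict_mem measurableSet_Ioc] with s hs
    exact (hB.memLp hs.1.le).integrable_sq
  · have h1 : IntegrableOn (fun s : ℝ => s) (Ioc 0 T) := continuous_id.integrableOn_Ioc
    refine h1.congr_fun (fun s hs => ?_) measurableSet_Ioc
    simp only [Function.uncurry, norm_pow, Real.norm_eq_abs, sq_abs]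
    exact (hB.integral_sq hs.1.le).symm

lemma continuousOn_integral_mul (hB : IsStdBrownian P F B) {Z : Ω → ℝ} (hZ : MemLp Z 2 P) :
    ContinuousOn (fun u => ∫ ω, Z ω * B u ω ∂P) (Ici 0) := by
  have key : ∀ s u : ℝ, 0 ≤ s → s ≤ u →
      |(∫ ω, Z ω * B u ω ∂P) - ∫ ω, Z ω * B s ω ∂P| ≤ √((∫ ω, Z ω ^ 2 ∂P) * |u - s|) := by
    intro s u hs hsu
    have hu : 0 ≤ u := hs.trans hsu
    have hiu : Integrable (fun ω => Z ω * B u ω) P := hZ.integrable_mul (hB.memLp hu)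
    have his : Integrable (fun ω => Z ω * B s ω) P := hZ.integrable_mul (hB.memLp hs)
    apply abs_le_sqrt
    rw [← MeasureTheory.integral_sub hiu his, abs_of_nonneg (sub_nonneg.2 hsu),
      ← hB.integral_sub_sq hs hsu]
    simp only [← mul_sub]
    exact sq_integral_mul_le hZ (hB.memLp_sub hs hsu)
  intro x hx
  rw [ContinuousWithinAt, tendsto_iff_dist_tendsto_zero]
  have hlim : Tendsto (fun u => √((∫ ω, Z ω ^ 2 ∂P) * |u - x|)) (nhdsWithin x (Ici 0))
      (nhds 0) := by
    have : Continuous fun u => √((∫ ω, Z ω ^ 2 ∂P) * |u - x|) := by fun_prop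
    have h1 := (this.tendsto x).mono_left (nhdsWithin_le_nhds (s := Ici 0))
    simpa using h1
  refine squeeze_zero' (Eventually.of_forall fun _ => dist_nonneg) ?_ hlim
  filter_upwards [self_mem_nhdsWithin] with u hu
  rw [Real.dist_eq]
  rcases le_total x u with h | h
  · exact key x u hx h
  · rw [abs_sub_comm, abs_sub_comm u x]
    exact key u x hu h

end IsStdBrownian

lemma isVolterraProcess_of_isSolutionSFDE {Ω : Type*} {mΩ : MeasurableSpace Ω} {P : Measure Ω}
    [IsFiniteMeasure P] {F : MeasureTheory.Filtration ℝ mΩ} {a b σ : ℝ} {ψ : ℝ → ℝ}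
    {B X : ℝ → Ω → ℝ} (hB : IsStdBrownian P F B) (hX : IsSolutionSFDE P F a b σ ψ B X) :
    IsVolterraSolution P a σ (ψ 0) (∫ u in (-1:ℝ)..(0:ℝ), ψ u) (fun s => b / (1 + |s|)) B
      fun s => X (max s 0) where
  measurable_noise := hB.measurable
  continuous_noise := hB.2.2.1
  memLp_noise := fun _ hs => hB.memLp hs
  memLp_uncurry_noise := hB.memLp_uncurry
  measurable := fun s => ((hX.1 _ (le_max_right s 0)).mono (F.le _)).measurable
  continuous := fun ω => (hX.2.1 ω).comp_continuous (f := fun u : ℝ => max u 0) (by fun_prop)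
    fun u => mem_Ici.2 (le_max_right _ _)
  eq_of_neg := fun s hs => by rw [max_eq_right hs, max_self]
  eqn := by
    filter_upwards [hX.2.2] with ω hω u hu
    rw [max_eq_left hu, hω u hu]
    congr 2
    refine intervalIntegral.integral_congr fun s hs => ?_
    rw [uIcc_of_le hu] at hs
    have h1 : ∫ w in (0:ℝ)..s, X (max w 0) ω = ∫ w in (0:ℝ)..s, X w ω := by
      refine intervalIntegral.integral_congr fun w hw => ?_
      rw [uIcc_of_le hs.1] at hw
      simp only [max_eq_left hw.1]
    simp only [max_eq_left hs.1, abs_of_nonneg hs.1, h1]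

theorem sfde_autocovariance_poly_decay_pos {Ω : Type*} {mΩ : MeasurableSpace Ω} (P : Measure Ω) [IsProbabilityMeasure P]
    (F : MeasureTheory.Filtration ℝ mΩ) (a b σ : ℝ) (ψ : ℝ → ℝ) (B X : ℝ → Ω → ℝ)
    (hσ : 0 < σ) (hψ : ContinuousOn ψ (Set.Icc (-1 : ℝ) 0))
    (hB : IsStdBrownian P F B) (hX : IsSolutionSFDE P F a b σ ψ B X)
    (ha : a < 0) (hb : 0 < b) (hab : a + b < 0) (t : ℝ) (ht : 0 < t) :
    ∃ c : ℝ, 0 < c ∧ Filter.Tendsto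
      (fun Δ : ℝ => Δ ^ (1 + b / a) * rcov P (X t) (X (t + Δ)))
      Filter.atTop (nhds c) := by
  have hV := isVolterraProcess_of_isSolutionSFDE hB hX
  set k : ℝ → ℝ := fun s => b / (1 + |s|) with hkdef
  set Y : ℝ → Ω → ℝ := fun s => X (max s 0) with hY
  have hYX : ∀ u, 0 ≤ u → Y u = X u := fun u hu => by simp only [hY, max_eq_left hu]
  have hk : Continuous k :=
    continuous_const.div (by fun_prop) fun s => by positivity
  have hk0 : ∀ u, 0 ≤ u → 0 ≤ k u := fun u _ => by positivity
  have hkb : ∀ u, 0 ≤ u → |k u| ≤ b := fun u hu => by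
    rw [abs_of_nonneg (hk0 u hu)]
    exact div_le_self hb.le (by linarith [abs_nonneg u])
  have hYL : ∀ u, 0 ≤ u → MemLp (Y u) 2 P := fun u hu => hV.memLp hb.le hσ.le hk hkb hu
  -- the solution is positively correlated with every increment of the noise
  have hincr : ∀ s v u, 0 ≤ s → s ≤ v → 0 ≤ u →
      exp (a * u) * (σ * (min v u - min s u)) ≤ ∫ ω, (B v ω - B s ω) * Y u ω ∂P := by
    intro s v u hs hsv hu
    have hv := hs.trans hsv
    have hZ := hB.memLp_sub hs hsv
    have hcorr : ∀ u, 0 ≤ u → ∫ ω, (B v ω - B s ω) * B u ω ∂P = min v u - min s u := by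
      intro u hu
      have h1 : Integrable (fun ω => B v ω * B u ω) P := (hB.memLp hv).integrable_mul (hB.memLp hu)
      have h2 : Integrable (fun ω => B s ω * B u ω) P := (hB.memLp hs).integrable_mul (hB.memLp hu)
      simp only [sub_mul]
      rw [integral_sub h1 h2, hB.integral_mul hv hu, hB.integral_mul hs hu]
    rw [← hcorr u hu]
    refine hV.exp_mul_le_test ha.le hb.le hσ.le hk hk0 hkb hZ (hB.integral_sub hs hsv)
      (hB.continuousOn_integral_mul hZ) ?_ (by simp [hB.2.1]) hu
    intro x hx y hy hxy
    simp only [hcorr x hx, hcorr y hy]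
    rcases min_cases v x with ⟨h1, h1'⟩ | ⟨h1, h1'⟩ <;>
    rcases min_cases s x with ⟨h2, h2'⟩ | ⟨h2, h2'⟩ <;>
    rcases min_cases v y with ⟨h3, h3'⟩ | ⟨h3, h3'⟩ <;>
    rcases min_cases s y with ⟨h4, h4'⟩ | ⟨h4, h4'⟩ <;> linarith
  set μ := ∫ ω, Y t ω ∂P with hμ
  set Z : Ω → ℝ := fun ω => Y t ω - μ with hZdef
  have hYt := hYL t ht.le
  have hYti : Integrable (Y t) P := hYt.integrable (by norm_num)
  have hZ : MemLp Z 2 P := hYt.sub (memLp_const μ)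
  have hZ0 : ∫ ω, Z ω ∂P = 0 := by
    simp only [hZdef]
    rw [integral_sub hYti (integrable_const _)]
    simp [hμ]
  have hZW : ∀ W : Ω → ℝ, MemLp W 2 P →
      ∫ ω, Z ω * W ω ∂P = (∫ ω, Y t ω * W ω ∂P) - μ * ∫ ω, W ω ∂P := by
    intro W hW
    have h1 : Integrable (fun ω => Y t ω * W ω) P := hYt.integrable_mul hW
    have h2 : Integrable W P := hW.integrable (by norm_num)
    simp only [hZdef, sub_mul]
    rw [integral_sub h1 (h2.const_mul _), integral_const_mul]
  set g : ℝ → ℝ := fun u => ∫ ω, Z ω * B u ω ∂P with hg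
  have hgsub : ∀ s v, 0 ≤ s → s ≤ v → g v - g s = ∫ ω, Y t ω * (B v ω - B s ω) ∂P := by
    intro s v hs hsv
    have h1 : Integrable (fun ω => Z ω * B v ω) P := hZ.integrable_mul (hB.memLp (hs.trans hsv))
    have h2 : Integrable (fun ω => Z ω * B s ω) P := hZ.integrable_mul (hB.memLp hs)
    simp only [hg]
    rw [← integral_sub h1 h2]
    simp only [← mul_sub]
    rw [hZW _ (hB.memLp_sub hs hsv), hB.integral_sub hs hsv, mul_zero, sub_zero]
  have hg0 : g 0 = 0 := by simp [hg, hB.2.1]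
  have hgmono : MonotoneOn g (Ici 0) := by
    intro s hs v hv hsv
    have h1 := hincr s v t hs hsv ht.le
    have h2 : 0 ≤ exp (a * t) * (σ * (min v t - min s t)) :=
      mul_nonneg (exp_pos _).le (mul_nonneg hσ.le (sub_nonneg.2 (min_le_min_right t hsv)))
    have h3 := hgsub s v hs hsv
    simp only [mul_comm (Y t _)] at h3
    linarith
  have hgt : 0 < g t := by
    have h1 := hincr 0 t t le_rfl ht.le ht.le
    have h3 := hgsub 0 t le_rfl ht.le
    simp only [mul_comm (Y t _)] at h3
    rw [hg0, sub_zero] at h3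
    rw [h3]
    refine lt_of_lt_of_le ?_ h1
    rw [min_self, min_eq_left ht.le, sub_zero]
    positivity
  have hgconst : ∀ u, t ≤ u → g u = g t := by
    intro u hu
    have h1 := hgsub t u ht.le hu
    rw [hYX t ht.le, hB.integral_mul_sub ht.le hu (hX.1 t ht.le).measurable] at h1
    linarith
  have hgcont := hB.continuousOn_integral_mul hZ
  set f : ℝ → ℝ := fun u => ∫ ω, Z ω * Y u ω ∂P with hf
  have hfc : Continuous f := hV.continuous_test hb.le hσ.le hk hkb hZ hZ0 hgcont
  have hflow : ∀ u, 0 ≤ u → exp (a * u) * (σ * g u) ≤ f u := fun u hu =>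
    hV.exp_mul_le_test ha.le hb.le hσ.le hk hk0 hkb hZ hZ0 hgcont hgmono hg0.ge hu
  have hgnn : ∀ u, 0 ≤ u → 0 ≤ g u := fun u hu => hg0 ▸ hgmono self_mem_Ici hu hu
  have hfnn : ∀ u, 0 ≤ u → 0 ≤ f u := fun u hu =>
    (mul_nonneg (exp_pos _).le (mul_nonneg hσ.le (hgnn u hu))).trans (hflow u hu)
  set y : ℝ → ℝ := fun u => ∫ s in (0:ℝ)..u, f s with hy
  have hy' : ∀ u, HasDerivAt y (f u) u := fun u => (hfc.integral_hasStrictDerivAt 0 u).hasDerivAt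
  have hyc : Continuous y := continuous_iff_continuousAt.2 fun s => (hy' s).continuousAt
  have hypos : 0 < y (t + 1) := by
    have ht1 : 0 < t + 1 := by linarith
    refine intervalIntegral.integral_pos ht1 hfc.continuousOn (fun x hx => hfnn x hx.1.le)
      ⟨t, ⟨ht.le, by linarith⟩, ?_⟩
    exact lt_of_lt_of_le (by positivity) (hflow t ht.le)
  have hf' : ∀ u, t + 1 ≤ u → HasDerivAt f (-(-a) * f u + b / (1 + u) * y u) u := by
    intro u hu
    have h1 : HasDerivAt (fun u => (∫ s in (0:ℝ)..u, (a * f s + k s * y s)) + σ * g t)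
        (a * f u + k u * y u) u :=
      (((hfc.const_mul a).add (hk.mul hyc)).integral_hasStrictDerivAt 0 u).hasDerivAt.add_const _
    have h2 : k u = b / (1 + u) := by simp only [hkdef, abs_of_nonneg (show 0 ≤ u by linarith)]
    rw [h2] at h1
    rw [neg_neg]
    refine h1.congr_of_eventuallyEq ?_
    filter_upwards [lt_mem_nhds (show t < u by linarith)] with v hv
    rw [← hgconst v hv.le]
    exact (hV.test_eq hb.le hσ.le hk hkb hZ hZ0 (ht.le.trans hv.le)).2
  obtain ⟨c, hc, hlim⟩ := exists_tendsto_rpow_mul_deriv (neg_pos.2 ha) hb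
    (show 0 ≤ t + 1 by linarith) (fun u _ => hy' u) hf' (fun u hu => hfnn u (by linarith)) hypos
  refine ⟨c, hc, ?_⟩
  have hexp : 1 - b / -a = 1 + b / a := by rw [div_neg]; ring
  rw [hexp] at hlim
  have hshift : Tendsto (fun Δ : ℝ => t + Δ) atTop atTop :=
    tendsto_atTop_add_const_left _ t tendsto_id
  have hratio : Tendsto (fun Δ : ℝ => (Δ / (1 + (t + Δ))) ^ (1 + b / a)) atTop (nhds 1) := by
    have h1 : Tendsto (fun Δ : ℝ => 1 - (1 + t) * (1 + (t + Δ))⁻¹) atTop (nhds 1) := by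
      have h2 : Tendsto (fun Δ : ℝ => (1 + (t + Δ))⁻¹) atTop (nhds 0) :=
        tendsto_inv_atTop_zero.comp (tendsto_atTop_add_const_left _ 1 hshift)
      simpa using (h2.const_mul (1 + t)).const_sub 1
    have h3 : Tendsto (fun Δ : ℝ => Δ / (1 + (t + Δ))) atTop (nhds 1) := by
      refine h1.congr' ?_
      filter_upwards [eventually_gt_atTop 0] with Δ hΔ
      have : 1 + (t + Δ) ≠ 0 := by positivity
      field_simp
      ring
    simpa using h3.rpow_const (p := 1 + b / a) (Or.inl one_ne_zero)
  have hprod := hratio.mul (hlim.comp hshift)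
  rw [one_mul] at hprod
  refine hprod.congr' ?_
  filter_upwards [eventually_gt_atTop 0] with Δ hΔ
  have hpos : 0 < 1 + (t + Δ) := by positivity
  have hcov : rcov P (X t) (X (t + Δ)) = f (t + Δ) := by
    have h0 : 0 ≤ t + Δ := by positivity
    simp only [hf]
    rw [hZW _ (hYL _ h0), hμ, hYX t ht.le, hYX _ h0, rcov]
  rw [hcov, Function.comp_apply, div_rpow hΔ.le hpos.le]
  have := (rpow_pos_of_pos hpos (1 + b / a)).ne'
  field_simp
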